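/- arXiv:2206.15319 — 10 statements merged into one kernel-verified Lean document; each statement's English description precedes it below -/
import Mathlib

section
/- Let x be an infinite word over a finite alphabet A that is aperiodic (i.e., not eventually periodic), and let ℓ ≥ 1. Extend the definition of boundary sets to all indices n ≥ 0. Then for every m with 0 ≤ m < ℓ, the boundary set ∂_{x,ℓ}[m] appears exactly once in the sequence (∂_{x,ℓ}[n])_{n≥0}; in particular, for all n > m one has ∂_{x,ℓ}[m] ≠ ∂_{x,ℓ}[n]. -/
/-- The `n`-th boundary set of the infinite word `x` with window length `ℓ`. -/
def boundarySet {A : Type*} (x : ℕ → A) (ℓ n : ℕ) :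
    Set ((Fin ℓ → A) × (Fin ℓ → A)) :=
  {p | ∃ i : ℕ, (∀ k : Fin ℓ, p.1 k = x (i + k)) ∧ (∀ k : Fin ℓ, p.2 k = x (i + n + k))}

/-- If `m < ℓ` and the boundary sets at `m` and `n` agree, then shifting `x` by `m` or by `n`
gives the same word, because the two windows at distance `m` overlap. -/
theorem apply_add_eq_of_boundarySet_eq {A : Type*} {x : ℕ → A} {ℓ m n : ℕ} (hm : m < ℓ)
    (h : boundarySet x ℓ m = boundarySet x ℓ n) (i : ℕ) : x (i + n) = x (i + m) := by
  have hmem : ((fun k : Fin ℓ => x (i + k)), fun k : Fin ℓ => x (i + n + k)) ∈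
      boundarySet x ℓ m := h ▸ ⟨i, fun _ => rfl, fun _ => rfl⟩
  obtain ⟨j, hj₁, hj₂⟩ := hmem
  exact (hj₂ ⟨0, by omega⟩).trans (hj₁ ⟨m, hm⟩).symm

/-- For an aperiodic word, a boundary set with index `m < ℓ` does not recur later. -/
theorem boundarySet_ne_of_lt {A : Type*} {x : ℕ → A}
    (haper : ¬ ∃ (N p : ℕ), 1 ≤ p ∧ ∀ n ≥ N, x (n + p) = x n)
    {ℓ m n : ℕ} (hm : m < ℓ) (hmn : m < n) : boundarySet x ℓ m ≠ boundarySet x ℓ n := by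
  intro h
  refine haper ⟨m, n - m, by omega, fun k hk => ?_⟩
  have hshift := apply_add_eq_of_boundarySet_eq hm h (k - m)
  rwa [show k - m + n = k + (n - m) by omega, show k - m + m = k by omega] at hshift

/-- if `x` is an aperiodic infinite word over a finite alphabet and
`ℓ ≥ 1`, then for every `m < ℓ` the boundary set `∂_{x,ℓ}[m]` appears exactly once in
the sequence `(∂_{x,ℓ}[n])_{n ≥ 0}`; in particular `∂_{x,ℓ}[m] ≠ ∂_{x,ℓ}[n]` for `n > m`. -/
theorem stmt0 {A : Type*} [Fintype A] (x : ℕ → A)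
    (haper : ¬ ∃ (N p : ℕ), 1 ≤ p ∧ ∀ n ≥ N, x (n + p) = x n)
    (ℓ : ℕ) (hℓ : 1 ≤ ℓ) :
    ∀ m < ℓ, ({n : ℕ | boundarySet x ℓ n = boundarySet x ℓ m} = {m}) ∧
      (∀ n : ℕ, m < n → boundarySet x ℓ m ≠ boundarySet x ℓ n) := by
  intro m hm
  refine ⟨Set.eq_singleton_iff_unique_mem.2 ⟨rfl, fun n hn => ?_⟩,
    fun n hmn => boundarySet_ne_of_lt haper hm hmn⟩
  rcases lt_trichotomy n m with hlt | heq | hgt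
  · exact (boundarySet_ne_of_lt haper (hlt.trans hm) hlt hn).elim
  · exact heq
  · exact (boundarySet_ne_of_lt haper hm hgt hn.symm).elim
end

section
/- Let x be an infinite word over a finite alphabet A that is eventually periodic, say there exist N ≥ 0 and p ≥ 1 with x[n+p] = x[n] for all n ≥ N. Then for every ℓ ≥ 1 and every n ≥ max(ℓ, N), one has ∂_{x,ℓ}[n+p] = ∂_{x,ℓ}[n]; in particular, the ℓ-boundary sequence of x is eventually periodic. -/
/-- Shifting the offset by a period does not change the boundary set, past the preperiod. -/
theorem boundarySet_add_period {A : Type*} {x : ℕ → A} {N p : ℕ}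
    (hper : ∀ n ≥ N, x (n + p) = x n) (ℓ : ℕ) {n : ℕ} (hn : N ≤ n) :
    boundarySet x ℓ (n + p) = boundarySet x ℓ n := by
  have hx (i k : ℕ) : x (i + (n + p) + k) = x (i + n + k) := by
    rw [← hper (i + n + k) (by omega)]
    congr 1
    omega
  simp only [boundarySet, hx]

/-- if `x` is eventually periodic (with preperiod `N` and period `p ≥ 1`),
then for every `ℓ ≥ 1` and every `n ≥ max ℓ N` one has `∂_{x,ℓ}[n+p] = ∂_{x,ℓ}[n]`;
in particular the `ℓ`-boundary sequence of `x` is eventually periodic. -/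
theorem stmt1 {A : Type*} [Fintype A] (x : ℕ → A) (N p : ℕ) (hp : 1 ≤ p)
    (hper : ∀ n ≥ N, x (n + p) = x n) (ℓ : ℕ) (hℓ : 1 ≤ ℓ) :
    (∀ n : ℕ, max ℓ N ≤ n → boundarySet x ℓ (n + p) = boundarySet x ℓ n) ∧
      (∃ (N' q : ℕ), 1 ≤ q ∧ ∀ n ≥ N',
        boundarySet x ℓ (n + q) = boundarySet x ℓ n) := by
  have h (n : ℕ) (hn : max ℓ N ≤ n) : boundarySet x ℓ (n + p) = boundarySet x ℓ n :=
    boundarySet_add_period hper ℓ (le_of_max_le_right hn)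
  exact ⟨h, max ℓ N, p, hp, h⟩
end

section
/- Let w : ℕ → {0,1} be an aperiodic infinite binary word having arbitrarily long blocks of 0s (i.e., for every k there exists i with w[i+j] = 0 for all j < k). Then for every k ≥ 1, the boundary set ∂_w[k] contains the three pairs (0,0), (0,1), (1,0), and (1,1) ∈ ∂_w[k] if and only if there exist integers m > n ≥ 0 with w[m] = w[n] = 1 and k = m − n. In particular, each ∂_w[k] equals either {(0,0),(0,1),(1,0)} or {0,1} × {0,1}. -/
/-- The `n`-th boundary set (window length `1`) of an infinite binary word. -/
def boundarySet1 (x : ℕ → Fin 2) (n : ℕ) : Set (Fin 2 × Fin 2) :=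
  {p | ∃ i : ℕ, p = (x i, x (i + n))}

theorem Fin.eq_zero_of_ne_one_two {a : Fin 2} (h : a ≠ 1) : a = 0 := by omega

/-- A word with a block of `k` zeros in which zeros persist under the shift by `k` is eventually
zero. -/
theorem eventually_zero_of_zero_shift {w : ℕ → Fin 2} {k s : ℕ} (hk : 1 ≤ k)
    (hs : ∀ j < k, w (s + j) = 0) (h : ∀ i, w i = 0 → w (i + k) = 0) :
    ∀ j, w (s + j) = 0 := by
  intro j
  induction j using Nat.strong_induction_on with
  | _ j ih =>
    rcases lt_or_ge j k with hj | hj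
    · exact hs j hj
    · have := h _ (ih (j - k) (by omega))
      rwa [show s + (j - k) + k = s + j by omega] at this

/-- A word with arbitrarily long blocks of zeros in which ones persist under the shift by `k ≥ 1`
is identically zero. -/
theorem eq_zero_of_one_shift {w : ℕ → Fin 2} {k : ℕ} (hk : 1 ≤ k)
    (hblocks : ∀ k : ℕ, ∃ i : ℕ, ∀ j < k, w (i + j) = 0)
    (h : ∀ i, w i = 1 → w (i + k) = 1) (i : ℕ) : w i = 0 := by
  refine Fin.eq_zero_of_ne_one_two fun hi => ?_
  have hmul : ∀ j, w (i + k * j) = 1 := by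
    intro j
    induction j with
    | zero => simpa using hi
    | succ j ih => simpa only [Nat.mul_succ, add_assoc] using h _ ih
  obtain ⟨s, hs⟩ := hblocks (i + k + 1)
  have hdiv := Nat.div_add_mod s k
  have hmod := Nat.mod_lt s hk
  have hone := hmul (s / k + 1)
  have hzero := hs (i + k * (s / k + 1) - s) (by rw [Nat.mul_succ]; omega)
  rw [Nat.add_sub_cancel' (by rw [Nat.mul_succ]; omega), hone] at hzero
  exact one_ne_zero hzero

/-- for an aperiodic binary word `w` with arbitrarily long blocks of `0`s,
every boundary set `∂_w[k]` (`k ≥ 1`) contains `(0,0), (0,1), (1,0)`, and it contains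
`(1,1)` iff `k = m - n` for some `m > n ≥ 0` with `w[m] = w[n] = 1`. In particular each
`∂_w[k]` is either `{(0,0),(0,1),(1,0)}` or all of `{0,1} × {0,1}`. -/
theorem stmt2 (w : ℕ → Fin 2)
    (haper : ¬ ∃ (N p : ℕ), 1 ≤ p ∧ ∀ n ≥ N, w (n + p) = w n)
    (hblocks : ∀ k : ℕ, ∃ i : ℕ, ∀ j < k, w (i + j) = 0) :
    ∀ k : ℕ, 1 ≤ k →
      ({((0 : Fin 2), (0 : Fin 2)), (0, 1), (1, 0)} ⊆ boundarySet1 w k) ∧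
      (((1 : Fin 2), (1 : Fin 2)) ∈ boundarySet1 w k ↔
        ∃ m n : ℕ, n < m ∧ w m = 1 ∧ w n = 1 ∧ m = n + k) ∧
      (boundarySet1 w k = {((0 : Fin 2), (0 : Fin 2)), (0, 1), (1, 0)} ∨
        boundarySet1 w k = Set.univ) := by
  intro k hk
  have h00 : ((0 : Fin 2), (0 : Fin 2)) ∈ boundarySet1 w k := by
    obtain ⟨s, hs⟩ := hblocks (k + 1)
    exact ⟨s, by rw [hs k (by omega), show w s = 0 from hs 0 (by omega)]⟩
  have h01 : ((0 : Fin 2), (1 : Fin 2)) ∈ boundarySet1 w k := by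
    by_contra hc
    obtain ⟨s, hs⟩ := hblocks k
    have hzero := eventually_zero_of_zero_shift hk hs fun i hi =>
      Fin.eq_zero_of_ne_one_two fun h1 => hc ⟨i, by rw [hi, h1]⟩
    refine haper ⟨s, 1, le_rfl, fun n hn => ?_⟩
    obtain ⟨d, rfl⟩ := Nat.exists_eq_add_of_le hn
    rw [add_assoc, hzero, hzero]
  have h10 : ((1 : Fin 2), (0 : Fin 2)) ∈ boundarySet1 w k := by
    by_contra hc
    have hzero := eq_zero_of_one_shift hk hblocks fun i hi => by
      by_contra h1
      exact hc ⟨i, by rw [hi, Fin.eq_zero_of_ne_one_two h1]⟩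
    exact haper ⟨0, 1, le_rfl, fun n _ => by rw [hzero, hzero]⟩
  have hsub : {((0 : Fin 2), (0 : Fin 2)), (0, 1), (1, 0)} ⊆ boundarySet1 w k := by
    rintro p (rfl | rfl | rfl) <;> assumption
  refine ⟨hsub, ⟨?_, ?_⟩, ?_⟩
  · rintro ⟨i, hi⟩
    obtain ⟨h1, h2⟩ := Prod.ext_iff.mp hi
    exact ⟨i + k, i, by omega, h2.symm, h1.symm, rfl⟩
  · rintro ⟨m, n, -, hm, hn, rfl⟩
    exact ⟨n, by rw [hn, hm]⟩
  · by_cases h11 : ((1 : Fin 2), (1 : Fin 2)) ∈ boundarySet1 w k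
    · right
      ext ⟨a, b⟩
      fin_cases a <;> fin_cases b <;> simpa
    · left
      refine Set.Subset.antisymm ?_ hsub
      rintro ⟨a, b⟩ hp
      fin_cases a <;> fin_cases b <;> first | exact absurd hp h11 | simp
end

section
/- Let w₁ : ℕ → {0,1} be the characteristic sequence of the set of triangular numbers. Then the boundary sequence of w₁ is constant: for every k ≥ 1, ∂_{w₁}[k] = {0,1} × {0,1}. -/
/-- No natural number strictly between two consecutive triangular numbers is triangular. -/
theorem two_mul_ne_mul_succ_of_between {m n : ℕ} (h₁ : m * (m + 1) < 2 * n)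
    (h₂ : 2 * n < (m + 1) * (m + 2)) : ¬ ∃ j : ℕ, 2 * n = j * (j + 1) := by
  rintro ⟨j, hj⟩
  rcases Nat.lt_or_ge m j with h | h
  · have : (m + 1) * (m + 2) ≤ j * (j + 1) := Nat.mul_le_mul h (by omega)
    omega
  · have : j * (j + 1) ≤ m * (m + 1) := Nat.mul_le_mul h (by omega)
    omega

/-- the boundary sequence of the characteristic sequence `w₁` of the
triangular numbers (`w₁[n] = 1` iff `2n = j(j+1)` for some `j`) is constant:
`∂_{w₁}[k] = {0,1} × {0,1}` for every `k ≥ 1`. -/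
theorem stmt3 (w : ℕ → Fin 2)
    (hw : ∀ n : ℕ, w n = 1 ↔ ∃ j : ℕ, 2 * n = j * (j + 1)) :
    ∀ k : ℕ, 1 ≤ k → boundarySet1 w k = Set.univ := by
  intro k hk
  have one {n : ℕ} (m : ℕ) (h : 2 * n = m * (m + 1)) : w n = 1 := (hw n).2 ⟨m, h⟩
  have zero {n : ℕ} (m : ℕ) (h₁ : m * (m + 1) < 2 * n) (h₂ : 2 * n < (m + 1) * (m + 2)) :
      w n = 0 := by
    have h : w n ≠ 1 := fun h => two_mul_ne_mul_succ_of_between h₁ h₂ ((hw n).1 h)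
    omega
  obtain ⟨t, ht⟩ := Nat.even_mul_succ_self k
  rw [Set.eq_univ_iff_forall]
  rintro ⟨a, b⟩
  change ∃ i : ℕ, (a, b) = (w i, w (i + k))
  fin_cases a <;> fin_cases b
  · refine ⟨t + k + 2, ?_⟩
    rw [zero (k + 1) (by linarith) (by linarith), zero (k + 1) (by linarith) (by linarith)]
    rfl
  · refine ⟨t + 1, ?_⟩
    rw [zero k (by linarith) (by linarith), one (k + 1) (by linarith)]
    rfl
  · refine ⟨t, ?_⟩
    rw [one k (by linarith), zero k (by linarith) (by linarith)]
    rfl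
  · obtain ⟨s, hs⟩ := Nat.even_mul_succ_self (k - 1)
    obtain ⟨m, rfl⟩ := Nat.exists_eq_add_of_le' hk
    rw [Nat.add_sub_cancel] at hs
    refine ⟨s, ?_⟩
    rw [one m (by linarith), one (m + 1) (by linarith)]
    rfl
end

section
/- Let ℓ ≥ 2 and let w₁ : ℕ → {0,1} be the characteristic sequence of the set of triangular numbers. There exist a set c ⊆ {0,1}^ℓ × {0,1}^ℓ and sets W₀, W₁, …, W_{T_{ℓ-1}} ⊆ {0,1}^ℓ × {0,1}^ℓ such that for every m > T_{ℓ-1}: (i) ∂_{w₁,ℓ}[n] = c for every n with T_m + 1 ≤ n ≤ T_{m+1} − T_{ℓ-1} − 1, and (ii) ∂_{w₁,ℓ}[T_{m+1} − i] = W_i for every i with 0 ≤ i ≤ T_{ℓ-1}. In particular, the ℓ-boundary sequence of w₁ is of the form p ∏_{n≥1} cⁿ w for a finite word p, a letter c and a finite word w of length T_{ℓ-1} + 1. -/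
/-- The `n`-th triangular number. -/
def tri (n : ℕ) : ℕ := n * (n + 1) / 2

theorem tri_succ (n : ℕ) : tri (n + 1) = tri n + (n + 1) := by
  unfold tri
  rw [show (n + 1) * (n + 1 + 1) = n * (n + 1) + (n + 1) * 2 by ring,
    Nat.add_mul_div_right _ _ (by norm_num)]

theorem two_mul_tri (n : ℕ) : 2 * tri n = n * (n + 1) :=
  Nat.mul_div_cancel' (Nat.even_mul_succ_self n).two_dvd

theorem tri_strictMono : StrictMono tri :=
  strictMono_nat_of_lt_succ fun n => by rw [tri_succ]; omega

theorem le_tri (n : ℕ) : n ≤ tri n := tri_strictMono.le_apply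

/-- No triangular number lies strictly between two consecutive ones. -/
theorem tri_ne_of_between {j x : ℕ} (h₁ : tri j < x) (h₂ : x < tri (j + 1)) (k : ℕ) :
    x ≠ tri k := by
  rintro rfl
  have := tri_strictMono.lt_iff_lt.mp h₁
  have := tri_strictMono.lt_iff_lt.mp h₂
  omega

/-- Beyond `tri L`, distinct triangular numbers are at distance at least `L + 2`. -/
theorem tri_eq_of_near {L i a b j k : ℕ} (hi : tri L < i) (ha : a < L + 2) (hb : b < L + 2)
    (hj : i + a = tri j) (hk : i + b = tri k) : a = b := by
  wlog h : j ≤ k generalizing a b j k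
  · exact (this hb ha hk hj (by omega)).symm
  obtain rfl | h := h.eq_or_lt
  · omega
  have hL : L < j := tri_strictMono.lt_iff_lt.mp (by omega)
  have := tri_strictMono.monotone (Nat.succ_le_of_lt h)
  rw [Nat.succ_eq_add_one, tri_succ] at this
  omega

/-- The binary word `u` has at most one letter equal to `1`. -/
def AtMostOneOne {ℓ : ℕ} (u : Fin ℓ → Fin 2) : Prop :=
  ∀ a b, u a = 1 → u b = 1 → a = b

theorem AtMostOneOne.eq_zero_or_single {ℓ : ℕ} {u : Fin ℓ → Fin 2} (h : AtMostOneOne u) :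
    (∀ k, u k ≠ 1) ∨ ∃ a, ∀ k, u k = 1 ↔ k = a := by
  by_cases hu : ∃ a, u a = 1
  · obtain ⟨a, ha⟩ := hu
    exact Or.inr ⟨a, fun k => ⟨fun hk => h k a hk ha, fun hk => hk ▸ ha⟩⟩
  · exact Or.inl (not_exists.mp hu)

theorem fin_two_eq_of_one_iff {a b : Fin 2} (h : a = 1 ↔ b = 1) : a = b := by
  omega

section Window

variable {w : ℕ → Fin 2}

theorem atMostOneOne_window (hw : ∀ n, w n = 1 ↔ ∃ j, n = tri j) {L i : ℕ} (hi : tri L < i)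
    {u : Fin (L + 2) → Fin 2} (hu : ∀ k, u k = w (i + k)) : AtMostOneOne u := by
  intro a b ha hb
  rw [hu, hw] at ha hb
  obtain ⟨j, hj⟩ := ha
  obtain ⟨k, hk⟩ := hb
  exact Fin.ext (tri_eq_of_near hi a.2 b.2 hj hk)

theorem eq_window_of_single (hw : ∀ n, w n = 1 ↔ ∃ j, n = tri j) {L i j : ℕ} (hi : tri L < i)
    {u : Fin (L + 2) → Fin 2} {a : Fin (L + 2)} (hu : ∀ k, u k = 1 ↔ k = a)
    (hj : i + a = tri j) (k : Fin (L + 2)) : u k = w (i + k) := by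
  refine fin_two_eq_of_one_iff ?_
  rw [hu, hw]
  constructor
  · rintro rfl
    exact ⟨j, hj⟩
  · rintro ⟨l, hl⟩
    exact Fin.ext (tri_eq_of_near hi k.2 a.2 hl hj)

theorem eq_window_of_zero (hw : ∀ n, w n = 1 ↔ ∃ j, n = tri j) {ℓ i j : ℕ} (h₁ : tri j < i)
    (h₂ : i + ℓ ≤ tri (j + 1)) {u : Fin ℓ → Fin 2} (hu : ∀ k, u k ≠ 1) (k : Fin ℓ) :
    u k = w (i + k) := by
  refine fin_two_eq_of_one_iff (iff_of_false (hu k) ?_)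
  rw [hw]
  rintro ⟨l, hl⟩
  exact tri_ne_of_between (j := j) (by omega) (by omega) l hl

/-- Every pair of words with at most one `1` each occurs at every large enough distance. -/
theorem mem_boundarySet_of_atMostOneOne (hw : ∀ n, w n = 1 ↔ ∃ j, n = tri j) {L n : ℕ}
    (hn : tri (L + 2) < n) {u v : Fin (L + 2) → Fin 2} (hu : AtMostOneOne u)
    (hv : AtMostOneOne v) : (u, v) ∈ boundarySet w (L + 2) n := by
  have hL₂ : tri (L + 2) = tri (L + 1) + (L + 2) := tri_succ (L + 1)
  have hL₁ := tri_succ L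
  have hbig := le_tri (n + 2 * L + 4)
  have hstep : tri (n + 2 * L + 5) = tri (n + 2 * L + 4) + (n + 2 * L + 5) :=
    tri_succ (n + 2 * L + 4)
  obtain hu | ⟨a, hu⟩ := hu.eq_zero_or_single <;> obtain hv | ⟨b, hv⟩ := hv.eq_zero_or_single
  · refine ⟨tri (n + 2 * L + 4) + 1, eq_window_of_zero hw (j := n + 2 * L + 4) ?_ (hstep ▸ ?_) hu,
      eq_window_of_zero hw (j := n + 2 * L + 4) ?_ (hstep ▸ ?_) hv⟩ <;> omega
  · have := b.2
    refine ⟨tri (n + 2 * L + 5) - n - b, eq_window_of_zero hw (j := n + 2 * L + 4) ?_ (hstep ▸ ?_) hu,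
      eq_window_of_single hw (j := n + 2 * L + 5) ?_ hv ?_⟩ <;> omega
  · have := a.2
    refine ⟨tri (n + 2 * L + 4) - a, eq_window_of_single hw (j := n + 2 * L + 4) ?_ hu ?_,
      eq_window_of_zero hw (j := n + 2 * L + 4) ?_ (hstep ▸ ?_) hv⟩ <;> omega
  · have := a.2
    have := b.2
    obtain ⟨N, hN⟩ : ∃ N, N + 1 + a = n + b := ⟨n + b - a - 1, by omega⟩
    have := le_tri N
    have := tri_succ N
    refine ⟨tri N - a, eq_window_of_single hw (j := N) ?_ hu ?_,
      eq_window_of_single hw (j := N + 1) ?_ hv ?_⟩ <;> omega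

/-- Pairs of words with at most one `1` each, together with the pairs whose first component is a
window of `w` starting at some `i ≤ tri L` and whose second component is the window at `i` of the
indicator of `f`. -/
def boundaryModel (w : ℕ → Fin 2) (L : ℕ) (f : ℕ → Prop) :
    Set ((Fin (L + 2) → Fin 2) × (Fin (L + 2) → Fin 2)) :=
  {p | (AtMostOneOne p.1 ∧ AtMostOneOne p.2) ∨
    ∃ i ≤ tri L, (∀ k : Fin (L + 2), p.1 k = w (i + k)) ∧
      ∀ k : Fin (L + 2), p.2 k = 1 ↔ f (i + k)}

theorem boundarySet_eq_boundaryModel (hw : ∀ n, w n = 1 ↔ ∃ j, n = tri j) {L n : ℕ}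
    (hn : tri (L + 2) < n) {f : ℕ → Prop}
    (hf : ∀ x ≤ tri (L + 1), (∃ j, n + x = tri j) ↔ f x) :
    boundarySet w (L + 2) n = boundaryModel w L f := by
  have hL₂ : tri (L + 2) = tri (L + 1) + (L + 2) := tri_succ (L + 1)
  have hL₁ := tri_succ L
  have key : ∀ i ≤ tri L, ∀ k : Fin (L + 2), w (i + n + k) = 1 ↔ f (i + k) := by
    intro i hi k
    rw [hw, ← hf _ (by omega), show i + n + k = n + (i + k) by omega]
  ext ⟨u, v⟩
  constructor
  · rintro ⟨i, hu, hv⟩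
    by_cases hi : i ≤ tri L
    · exact Or.inr ⟨i, hi, hu, fun k => by rw [hv, key i hi]⟩
    · exact Or.inl ⟨atMostOneOne_window hw (by omega) hu,
        atMostOneOne_window hw (i := i + n) (by omega) hv⟩
  · rintro (⟨hu, hv⟩ | ⟨i, hi, hu, hv⟩)
    · exact mem_boundarySet_of_atMostOneOne hw hn hu hv
    · exact ⟨i, hu, fun k => fin_two_eq_of_one_iff ((hv k).trans (key i hi k).symm)⟩

end Window

/-- let `ℓ ≥ 2` and let `w₁` be the characteristic sequence of the
triangular numbers. There exist a boundary set `c` and boundary sets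
`W₀, …, W_{T_{ℓ-1}}` such that for every `m > T_{ℓ-1}`:
(i) `∂_{w₁,ℓ}[n] = c` for all `T_m + 1 ≤ n ≤ T_{m+1} − T_{ℓ-1} − 1`, and
(ii) `∂_{w₁,ℓ}[T_{m+1} − i] = W_i` for all `0 ≤ i ≤ T_{ℓ-1}`. -/
theorem stmt4 (ℓ : ℕ) (hℓ : 2 ≤ ℓ) (w : ℕ → Fin 2)
    (hw : ∀ n : ℕ, w n = 1 ↔ ∃ j : ℕ, 2 * n = j * (j + 1)) :
    ∃ (c : Set ((Fin ℓ → Fin 2) × (Fin ℓ → Fin 2)))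
      (W : ℕ → Set ((Fin ℓ → Fin 2) × (Fin ℓ → Fin 2))),
      ∀ m : ℕ, tri (ℓ - 1) < m →
        (∀ n : ℕ, tri m + 1 ≤ n → n ≤ tri (m + 1) - tri (ℓ - 1) - 1 →
          boundarySet w ℓ n = c) ∧
        (∀ i : ℕ, i ≤ tri (ℓ - 1) →
          boundarySet w ℓ (tri (m + 1) - i) = W i) := by
  obtain ⟨L, rfl⟩ : ∃ L, ℓ = L + 2 := ⟨ℓ - 2, by omega⟩
  have hw' : ∀ n, w n = 1 ↔ ∃ j, n = tri j := fun n => (hw n).trans <|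
    exists_congr fun j => by rw [← two_mul_tri]; omega
  refine ⟨boundaryModel w L fun _ => False, fun i => boundaryModel w L fun x => x = i, ?_⟩
  rw [show L + 2 - 1 = L + 1 by omega]
  intro m hm
  have hLm : L + 2 ≤ m := by have := le_tri (L + 1); omega
  have hmono := tri_strictMono.monotone hLm
  have hm₁ := tri_succ m
  have hm₂ := tri_succ (m + 1)
  refine ⟨fun n hn₁ hn₂ => ?_, fun i hi => ?_⟩
  · refine boundarySet_eq_boundaryModel hw' (by omega) fun x hx => iff_of_false ?_ id
    rintro ⟨j, hj⟩
    exact tri_ne_of_between (j := m) (by omega) (by omega) j hj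
  · refine boundarySet_eq_boundaryModel hw' (by omega) fun x hx => ⟨?_, ?_⟩
    · rintro ⟨j, hj⟩
      by_contra hne
      obtain h | h := Nat.lt_or_gt_of_ne hne
      · exact tri_ne_of_between (j := m) (by omega) (by omega) j hj
      · exact tri_ne_of_between (j := m + 1) (by omega) (by omega) j hj
    · rintro rfl
      exact ⟨m + 1, by omega⟩
end

section
/- Let w₂ : ℕ → {0,1} be the characteristic sequence of the set of perfect squares (w₂[n] = 1 iff n is a square). Then the boundary sequence of w₂ is periodic with period 4: for every k ≥ 1, ∂_{w₂}[k] = {(0,0),(0,1),(1,0)} if k ≡ 2 (mod 4), and ∂_{w₂}[k] = {0,1} × {0,1} otherwise. -/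
theorem ne_mul_self_of_lt_of_lt {a n : ℕ} (h₁ : a * a < n) (h₂ : n < (a + 1) * (a + 1)) (j : ℕ) :
    n ≠ j * j := by
  rintro rfl
  have := Nat.mul_self_lt_mul_self_iff.mp h₁
  have := Nat.mul_self_lt_mul_self_iff.mp h₂
  omega

theorem mul_self_mod_four (a : ℕ) : a * a % 4 = 0 ∨ a * a % 4 = 1 := by
  have ha : a % 4 < 4 := Nat.mod_lt _ (by norm_num)
  rw [Nat.mul_mod]
  interval_cases a % 4 <;> simp

theorem mul_self_add_ne_mul_self {k : ℕ} (hk : k % 4 = 2) (a b : ℕ) : a * a + k ≠ b * b := by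
  have ha := mul_self_mod_four a
  have hb := mul_self_mod_four b
  omega

theorem exists_mul_self_add_eq_mul_self {k : ℕ} (hk : k % 4 ≠ 2) :
    ∃ a b : ℕ, a * a + k = b * b := by
  rcases Nat.even_or_odd' k with ⟨m, rfl | rfl⟩
  · obtain ⟨t, rfl⟩ : ∃ t, m = 2 * t := ⟨m / 2, by omega⟩
    rcases t with _ | t
    · exact ⟨0, 0, rfl⟩
    · exact ⟨t, t + 2, by ring⟩
  · exact ⟨m, m + 1, by ring⟩

/-- the boundary sequence of the characteristic sequence `w₂` of the
perfect squares is periodic with period `4`: for every `k ≥ 1`,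
`∂_{w₂}[k] = {(0,0),(0,1),(1,0)}` if `k ≡ 2 (mod 4)` and `∂_{w₂}[k] = {0,1} × {0,1}`
otherwise. -/
theorem stmt5 (w : ℕ → Fin 2)
    (hw : ∀ n : ℕ, w n = 1 ↔ ∃ j : ℕ, n = j * j) :
    ∀ k : ℕ, 1 ≤ k →
      (k % 4 = 2 → boundarySet1 w k = {((0 : Fin 2), (0 : Fin 2)), (0, 1), (1, 0)}) ∧
      (k % 4 ≠ 2 → boundarySet1 w k = Set.univ) := by
  intro k hk
  have hw₀ : ∀ n, w n = 0 ↔ ∀ j : ℕ, n ≠ j * j := fun n => by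
    rw [← not_exists, ← hw]
    omega
  have h_nonsquare : ∀ t, 0 < t → t < 2 * k + 3 → w ((k + 1) * (k + 1) + t) = 0 :=
    fun t h₁ h₂ => (hw₀ _).2 (ne_mul_self_of_lt_of_lt (a := k + 1) (by omega) (by linarith))
  have h_square : w ((k + 1) * (k + 1)) = 1 := (hw _).2 ⟨k + 1, rfl⟩
  have h00 : ((0 : Fin 2), (0 : Fin 2)) ∈ boundarySet1 w k :=
    ⟨(k + 1) * (k + 1) + 1, by
      rw [h_nonsquare 1 (by omega) (by omega), add_assoc,
        h_nonsquare (1 + k) (by omega) (by omega)]⟩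
  have h10 : ((1 : Fin 2), (0 : Fin 2)) ∈ boundarySet1 w k :=
    ⟨(k + 1) * (k + 1), by rw [h_square, h_nonsquare k (by omega) (by omega)]⟩
  have h01 : ((0 : Fin 2), (1 : Fin 2)) ∈ boundarySet1 w k :=
    ⟨(k + 1) * (k + 1) + (k + 3), by
      rw [h_nonsquare (k + 3) (by omega) (by omega), (hw _).2 ⟨k + 2, by ring⟩]⟩
  have eq_zero_or_one : ∀ a : Fin 2, a = 0 ∨ a = 1 := by decide
  constructor
  · intro hk₂
    apply Set.Subset.antisymm
    · rintro _ ⟨i, rfl⟩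
      rcases eq_zero_or_one (w i) with h | h <;> rcases eq_zero_or_one (w (i + k)) with h' | h'
      · simp [h, h']
      · simp [h, h']
      · simp [h, h']
      · obtain ⟨a, rfl⟩ := (hw _).1 h
        obtain ⟨b, hb⟩ := (hw _).1 h'
        exact absurd hb (mul_self_add_ne_mul_self hk₂ a b)
    · rintro _ (rfl | rfl | rfl)
      exacts [h00, h01, h10]
  · intro hk₂
    obtain ⟨a, b, hab⟩ := exists_mul_self_add_eq_mul_self hk₂
    have h11 : ((1 : Fin 2), (1 : Fin 2)) ∈ boundarySet1 w k :=
      ⟨a * a, by rw [(hw _).2 ⟨a, rfl⟩, (hw _).2 ⟨b, hab⟩]⟩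
    refine Set.eq_univ_of_forall fun ⟨x, y⟩ => ?_
    rcases eq_zero_or_one x with rfl | rfl <;> rcases eq_zero_or_one y with rfl | rfl
    exacts [h00, h01, h10, h11]
end

section
/- Let s ≥ 3 be an odd integer, set P_n := n(s·n − s + 2)/2, and let p be a prime number with p ≡ 1 (mod s). Then for all integers i, j ≥ 0, the number s^i · p^j is representable as a difference P_m − P_n with m > n ≥ 0 if and only if p^j ≥ s·(s^i − 1)/2 + 1. -/
/-- `P s n = n (s n - s + 2) / 2`, the generalized polygonal numbers. -/
def Ppoly (s n : ℕ) : ℕ := n * (s * n - s + 2) / 2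

theorem two_mul_Ppoly_add (s n : ℕ) :
    2 * Ppoly s n + s * n = s * n ^ 2 + 2 * n := by
  cases n with
  | zero => simp [Ppoly]
  | succ k =>
    have hsub : s * (k + 1) - s + 2 = s * k + 2 := by
      rw [mul_add, mul_one, Nat.add_sub_cancel]
    have heven : 2 ∣ (k + 1) * (s * k + 2) := by
      obtain ⟨c, hc⟩ := (Nat.even_mul_succ_self k).two_dvd
      refine ⟨s * c + (k + 1), ?_⟩
      linear_combination s * hc
    rw [Ppoly, hsub, Nat.mul_div_cancel' heven]
    ring

theorem add_Ppoly_eq_Ppoly_iff (s k n c : ℕ) :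
    k + Ppoly s n = Ppoly s (n + (c + 1)) ↔
      2 * k = (c + 1) * (s * (c + 2 * n) + 2) := by
  have h₁ := two_mul_Ppoly_add s n
  have h₂ := two_mul_Ppoly_add s (n + (c + 1))
  constructor
  · intro h
    zify at *
    linear_combination 2 * h + h₂ - h₁
  · intro h
    zify at *
    refine mul_left_cancel₀ two_ne_zero ?_
    linear_combination h + h₁ - h₂

theorem coprime_mul_add_two {s : ℕ} (hodd : Odd s) (x : ℕ) :
    Nat.Coprime s (s * x + 2) := by
  rw [Nat.coprime_mul_left_add_right]
  exact hodd.coprime_two_right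

/-- let `s ≥ 3` be odd and `p` a prime with `p ≡ 1 (mod s)`. Then for all
`i, j ≥ 0`, the number `s^i p^j` is representable as `P_m − P_n` with `m > n ≥ 0`
iff `p^j ≥ s(s^i − 1)/2 + 1`. -/
theorem stmt6 (s : ℕ) (hs : 3 ≤ s) (hodd : Odd s) (p : ℕ) (hp : p.Prime)
    (hps : p % s = 1) :
    ∀ i j : ℕ,
      (∃ m n : ℕ, n < m ∧ s ^ i * p ^ j + Ppoly s n = Ppoly s m) ↔
        s * (s ^ i - 1) / 2 + 1 ≤ p ^ j := by
  intro i j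
  obtain ⟨u, hu⟩ : ∃ u, s ^ i = 2 * u + 1 := hodd.pow
  have hhalf : s * (s ^ i - 1) / 2 = s * u := by
    rw [hu, Nat.add_sub_cancel, mul_left_comm, Nat.mul_div_cancel_left _ two_pos]
  rw [hhalf]
  constructor
  · rintro ⟨m, n, hnm, h⟩
    obtain ⟨c, rfl⟩ : ∃ c, m = n + (c + 1) := ⟨m - n - 1, by omega⟩
    rw [add_Ppoly_eq_Ppoly_iff] at h
    set e := s * (c + 2 * n) + 2 with he
    have hcop : Nat.Coprime (s ^ i) e := (coprime_mul_add_two hodd _).pow_left i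
    have hc : s ^ i ≤ c + 1 :=
      Nat.le_of_dvd c.succ_pos (hcop.dvd_of_dvd_mul_right ⟨2 * p ^ j, by rw [← h]; ring⟩)
    have hdvd : e ∣ 2 * p ^ j :=
      hcop.symm.dvd_of_dvd_mul_left ⟨c + 1, by rw [mul_comm e, ← h]; ring⟩
    have hle : e ≤ 2 * p ^ j := Nat.le_of_dvd (mul_pos two_pos (pow_pos hp.pos j)) hdvd
    have hmul : s * (2 * u) ≤ s * (c + 2 * n) := Nat.mul_le_mul_left s (by omega)
    have hassoc : s * (2 * u) = 2 * (s * u) := by ring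
    omega
  · intro h
    have hmod : p ^ j % s = 1 := by
      rw [Nat.pow_mod, hps, one_pow, Nat.mod_eq_of_lt (by omega)]
    obtain ⟨t, ht⟩ : ∃ t, p ^ j = s * t + 1 :=
      ⟨p ^ j / s, by rw [← hmod, Nat.div_add_mod]⟩
    have hut : u ≤ t := Nat.le_of_mul_le_mul_left (by omega : s * u ≤ s * t) (by omega)
    obtain ⟨n, rfl⟩ := Nat.exists_eq_add_of_le hut
    refine ⟨n + (2 * u + 1), n, by omega, ?_⟩
    rw [add_Ppoly_eq_Ppoly_iff, hu, ht]
    ring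
end

section
/- Let s ≥ 3 be an integer and let X := {P_m − P_n : m > n ≥ 0} where P_n := n(s·n − s + 2)/2. Then the characteristic sequence of X is not eventually periodic; equivalently, there exist no N ≥ 0 and p ≥ 1 such that for all k ≥ N, k ∈ X if and only if k + p ∈ X. (Consequently, the boundary sequence of the characteristic sequence of {P_n : n ≥ 0} is aperiodic.) -/
theorem two_mul_Ppoly (s n : ℕ) : 2 * Ppoly s n + s * n = s * n * n + 2 * n := by
  cases n with
  | zero => simp [Ppoly]
  | succ c =>
    have hsub : s * (c + 1) - s = s * c := by rw [Nat.mul_succ, Nat.add_sub_cancel]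
    have heven : 2 ∣ (c + 1) * (s * c + 2) := by
      have h : 2 ∣ c * (c + 1) := (Nat.even_mul_succ_self c).two_dvd
      have : (c + 1) * (s * c + 2) = s * (c * (c + 1)) + 2 * (c + 1) := by ring
      rw [this]
      exact dvd_add (h.mul_left s) (dvd_mul_right 2 _)
    rw [Ppoly, hsub, Nat.mul_div_cancel' heven]
    ring

/-- `k` is a difference of two values of `Ppoly s`, with `c + 1` the difference of the indices,
iff `2 * k` has a suitable factorization. -/
theorem exists_add_Ppoly_eq_iff (s k : ℕ) :
    (∃ m n : ℕ, n < m ∧ k + Ppoly s n = Ppoly s m) ↔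
      ∃ c n : ℕ, 2 * k = (c + 1) * (s * (c + 2 * n) + 2) := by
  constructor
  · rintro ⟨m, n, hnm, h⟩
    obtain ⟨c, rfl⟩ := Nat.exists_eq_add_of_lt hnm
    refine ⟨c, n, ?_⟩
    have h1 := two_mul_Ppoly s n
    have h2 := two_mul_Ppoly s (n + c + 1)
    zify at *
    linear_combination 2 * h + h2 - h1
  · rintro ⟨c, n, h⟩
    refine ⟨n + c + 1, n, by omega, ?_⟩
    have h1 := two_mul_Ppoly s n
    have h2 := two_mul_Ppoly s (n + c + 1)
    have : 2 * (k + Ppoly s n) = 2 * Ppoly s (n + c + 1) := by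
      zify at *
      linear_combination h + h1 - h2
    omega

theorem iff_add_mul_of_iff_add {X : ℕ → Prop} {N p : ℕ} (h : ∀ k ≥ N, (X k ↔ X (k + p)))
    (j k : ℕ) (hk : N ≤ k) : X k ↔ X (k + p * j) := by
  induction j with
  | zero => simp
  | succ j ih => rw [ih, h _ (by omega), Nat.mul_succ, ← add_assoc]

/-- If `2 * k = a * q` with `q` a large prime and `a ≤ 4`, then in any factorization
witnessing that `k` is a difference, the first factor divides `a`. -/
theorem succ_dvd_of_mul_prime_eq {s q a c n : ℕ} (hs : 3 ≤ s) (hq : q.Prime) (hq3 : 3 ≤ q)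
    (ha : a ≤ 4) (h : a * q = (c + 1) * (s * (c + 2 * n) + 2)) : c + 1 ∣ a := by
  have hdvd : c + 1 ∣ a * q := ⟨_, h⟩
  by_cases hqc : q ∣ c + 1
  · exfalso
    have hle : q ≤ c + 1 := Nat.le_of_dvd (by omega) hqc
    have h1 : 3 * 2 ≤ s * (c + 2 * n) := Nat.mul_le_mul hs (by omega)
    have h2 : q * 8 ≤ (c + 1) * (s * (c + 2 * n) + 2) := Nat.mul_le_mul hle (by omega)
    have h3 : a * q ≤ 4 * q := Nat.mul_le_mul_right q ha
    omega
  · exact ((Nat.Prime.coprime_iff_not_dvd hq).2 hqc).symm.dvd_of_dvd_mul_right hdvd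

theorem prime_not_difference {s q : ℕ} (hs : 4 ≤ s) (hq : q.Prime) (hq3 : 3 ≤ q)
    (hsq : s ∣ q + 1) : ¬ ∃ c n : ℕ, 2 * q = (c + 1) * (s * (c + 2 * n) + 2) := by
  rintro ⟨c, n, h⟩
  have hc := succ_dvd_of_mul_prime_eq (by omega) hq hq3 (by norm_num) h
  have hc2 := Nat.le_of_dvd (by norm_num) hc
  obtain rfl | rfl : c = 0 ∨ c = 1 := by omega
  · have hs2 : s ∣ 2 := by
      refine (Nat.dvd_add_right (dvd_mul_right s n)).1 ?_
      convert hsq using 1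
      linarith
    have := Nat.le_of_dvd (by norm_num) hs2
    omega
  · have hs3 : s ∣ 3 := by
      refine (Nat.dvd_add_right (dvd_mul_right s (1 + 2 * n))).1 ?_
      convert hsq using 1
      linarith
    have := Nat.le_of_dvd (by norm_num) hs3
    omega

theorem two_mul_prime_not_difference {q : ℕ} (hq : q.Prime) (hq3 : 3 ≤ q) (hq6 : q % 6 = 1) :
    ¬ ∃ c n : ℕ, 2 * (2 * q) = (c + 1) * (3 * (c + 2 * n) + 2) := by
  rintro ⟨c, n, h⟩
  rw [← mul_assoc] at h
  have hc := succ_dvd_of_mul_prime_eq le_rfl hq hq3 (by norm_num) h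
  have hc4 := Nat.le_of_dvd (by norm_num) hc
  have : c ≤ 3 := by omega
  interval_cases c <;> omega

/-- for `s ≥ 3`, the set `X = {P_m − P_n : m > n ≥ 0}` is not eventually
periodic: there are no `N ≥ 0` and `p ≥ 1` such that for all `k ≥ N`,
`k ∈ X ↔ k + p ∈ X`. -/
theorem stmt8 (s : ℕ) (hs : 3 ≤ s) :
    ¬ ∃ (N p : ℕ), 1 ≤ p ∧ ∀ k ≥ N,
      ((∃ m n : ℕ, n < m ∧ k + Ppoly s n = Ppoly s m) ↔
        (∃ m n : ℕ, n < m ∧ (k + p) + Ppoly s n = Ppoly s m)) := by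
  rintro ⟨N, p, hp, h⟩
  simp only [exists_add_Ppoly_eq_iff] at h
  have hper := iff_add_mul_of_iff_add h
  -- a multiple of the period that is larger than `N`
  obtain ⟨r, hr, hrN⟩ : ∃ r, p ∣ r ∧ N < r :=
    ⟨p * (N + 1), dvd_mul_right _ _, Nat.le_mul_of_pos_left (N + 1) hp⟩
  have key : ∀ k l : ℕ, N ≤ k → k ≤ l → (r : ℤ) ∣ l - k →
      (∃ c n : ℕ, 2 * k = (c + 1) * (s * (c + 2 * n) + 2)) →
      ∃ c n : ℕ, 2 * l = (c + 1) * (s * (c + 2 * n) + 2) := by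
    intro k l hk hkl hd hX
    have hd' : p ∣ l - k := hr.trans (by exact_mod_cast (Nat.cast_sub (R := ℤ) hkl) ▸ hd)
    obtain ⟨j, hj⟩ := hd'
    obtain rfl : l = k + p * j := by omega
    exact (hper j k hk).1 hX
  have hsr : 3 * r ≤ s * r := Nat.mul_le_mul_right r hs
  obtain hs4 | rfl : 4 ≤ s ∨ s = 3 := by omega
  · obtain ⟨d, hd⟩ : ∃ d, d + 2 = 2 * (s * r) := ⟨2 * (s * r) - 2, by omega⟩
    obtain ⟨q, hqk, hq, hqm⟩ := Nat.forall_exists_prime_gt_and_modEq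
      ((d + 1) * (1 + s * (s * r))) (q := d + 2) (a := d + 1) (by omega)
      ((Nat.coprime_self_add_right (m := d + 1) (n := 1)).2 (Nat.coprime_one_right _))
    have hqd : d + 2 ∣ q + 1 := (Nat.modEq_zero_iff_dvd.1
      ((hqm.add_right 1).trans (by simp [Nat.ModEq])))
    have hdq : d + 1 ≤ (d + 1) * (1 + s * (s * r)) := Nat.le_mul_of_pos_right _ (by omega)
    refine prime_not_difference hs4 hq (by omega) ?_
      (key ((d + 1) * (1 + s * (s * r))) q (by omega) hqk.le ?_ ⟨d, 1, ?_⟩)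
    · exact (Dvd.intro (2 * r) (by rw [hd]; ring)).trans hqd
    · obtain ⟨j, hj⟩ := hqd
      refine ⟨2 * s * j - 2 * s - (d + 1) * s * s, ?_⟩
      zify at hj hd
      push_cast
      linear_combination hj + (j - 1) * hd
    · rw [hd]; ring
  · obtain ⟨q, hqk, hq, hqm⟩ := Nat.forall_exists_prime_gt_and_modEq
      ((6 * r - 1) * (12 * r - 2)) (q := 6 * r) (a := 1) (by omega) (by simp)
    obtain ⟨d, hd⟩ : ∃ d, d + 2 = 6 * r := ⟨6 * r - 2, by omega⟩
    have e1 : 6 * r - 1 = d + 1 := by omega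
    have e2 : 12 * r - 2 = 2 * (d + 1) := by omega
    rw [e1, e2] at hqk
    have hdq : (d + 1) * 1 ≤ (d + 1) * (2 * (d + 1)) := Nat.mul_le_mul_left _ (by omega)
    obtain ⟨j, hj⟩ := (Nat.modEq_iff_dvd' hq.one_lt.le).1 hqm.symm
    have hj' : q = 6 * (r * j) + 1 := by rw [← mul_assoc, ← hj]; have := hq.one_lt; omega
    refine two_mul_prime_not_difference hq (by omega) (by omega)
      (key ((d + 1) * (2 * (d + 1))) (2 * q) (by omega) (by omega) ?_ ⟨d, r, ?_⟩)
    · refine ⟨12 * j - 12 * (d : ℤ), ?_⟩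
      zify at hj' hd
      push_cast
      linear_combination 2 * hj' - 2 * d * hd
    · have : 3 * (d + 2 * r) + 2 = 4 * (d + 1) := by omega
      rw [this]; ring
end

section
/- Let U_n := 2^{n+1} − 1 for n ≥ 0. Call a finite word c_{t-1}⋯c_1c_0 over the digit alphabet {0,1,2} (written most significant digit first) a greedy U-representation if it is empty or its leading digit c_{t-1} is nonzero, and for every j < t one has Σ_{i≤j} c_i·U_i < U_{j+1}; its value is Σ_{i<t} c_i·U_i. Let X := {2^{m+1} − 2^{n+1} : m > n ≥ 0}. Then the language R over {0,1,2} consisting of all greedy U-representations whose value lies in X is not a regular language. -/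
/-- The numeration basis `U_n = 2^{n+1} − 1`. -/
def Useq (n : ℕ) : ℕ := 2 ^ (n + 1) - 1

/-- The value of a digit word written least significant digit first. -/
def valU (l : List ℕ) : ℕ := ∑ i ∈ Finset.range l.length, l.getD i 0 * Useq i

/-- A finite word over `{0,1,2}`, written most significant digit first, is a greedy
`U`-representation if it is empty or its leading digit is nonzero, and for every
`j < t` one has `Σ_{i ≤ j} c_i U_i < U_{j+1}`. -/
def IsGreedyU (w : List (Fin 3)) : Prop :=
  w.head? ≠ some 0 ∧
    ∀ j < (w.map Fin.val).reverse.length,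
      (∑ i ∈ Finset.range (j + 1), (w.map Fin.val).reverse.getD i 0 * Useq i) <
        Useq (j + 1)

/-- The word `1^d 0 1 0^t`, most significant digit first. -/
def onesWord (d t : ℕ) : List (Fin 3) :=
  List.replicate d 1 ++ ([0, 1] ++ List.replicate t 0)

theorem onesWord_reverse (d t : ℕ) :
    ((onesWord d t).map Fin.val).reverse =
      List.replicate t 0 ++ ([1, 0] ++ List.replicate d 1) := by
  simp [onesWord]

theorem getD_onesWord (d t i : ℕ) :
    ((onesWord d t).map Fin.val).reverse.getD i 0 =
      if i = t ∨ (t + 2 ≤ i ∧ i < t + 2 + d) then 1 else 0 := by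
  rw [onesWord_reverse]
  rcases lt_or_ge i t with h | h
  · rw [List.getD_append _ _ _ _ (by simpa using h), if_neg (by omega)]
    simp [List.getD_eq_getElem?_getD, h]
  · obtain ⟨k, rfl⟩ := Nat.exists_eq_add_of_le h
    rw [List.getD_append_right _ _ _ _ (by simp)]
    match k with
    | 0 => simp
    | 1 => simp
    | k + 2 =>
      by_cases hk : k < d
      · rw [if_pos (by omega)]
        simp [List.getD_eq_getElem?_getD, hk]
      · rw [if_neg (by omega)]
        simp [List.getD_eq_getElem?_getD, hk]

theorem length_onesWord (d t : ℕ) :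
    ((onesWord d t).map Fin.val).reverse.length = t + 2 + d := by
  simp [onesWord]
  omega

/-- The value of the `k` least significant digits of `onesWord d t`. -/
def onesSum (d t k : ℕ) : ℕ :=
  ∑ i ∈ Finset.range k, ((onesWord d t).map Fin.val).reverse.getD i 0 * Useq i

theorem onesSum_of_le {d t k : ℕ} (h : k ≤ t) : onesSum d t k = 0 := by
  refine Finset.sum_eq_zero fun i hi => ?_
  rw [Finset.mem_range] at hi
  rw [getD_onesWord, if_neg (by omega), zero_mul]

theorem onesSum_succ_self (d t : ℕ) : onesSum d t (t + 1) = Useq t := by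
  have h : onesSum d t (t + 1) = onesSum d t t + _ := Finset.sum_range_succ _ _
  rw [h, onesSum_of_le le_rfl, getD_onesWord, if_pos (by omega), zero_add, one_mul]

theorem onesSum_add_two (d t : ℕ) : onesSum d t (t + 2) = Useq t := by
  have h : onesSum d t (t + 2) = onesSum d t (t + 1) + _ := Finset.sum_range_succ _ _
  rw [h, onesSum_succ_self, getD_onesWord, if_neg (by omega), zero_mul, add_zero]

theorem Useq_add_one (n : ℕ) : Useq n + 1 = 2 ^ (n + 1) :=
  Nat.sub_add_cancel Nat.one_le_two_pow

theorem onesSum_add {d t k : ℕ} (hk : k ≤ d) :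
    onesSum d t (t + 2 + k) + 2 ^ (t + 3) + k = 2 ^ (t + 3 + k) + Useq t := by
  induction k with
  | zero => rw [add_zero, onesSum_add_two]; ring
  | succ k ih =>
    have h : onesSum d t (t + 2 + (k + 1)) = onesSum d t (t + 2 + k) +
        ((onesWord d t).map Fin.val).reverse.getD (t + 2 + k) 0 * Useq (t + 2 + k) :=
      Finset.sum_range_succ _ _
    rw [getD_onesWord, if_pos (by omega), one_mul] at h
    have hU := Useq_add_one (t + 2 + k)
    have hp : 2 ^ (t + 3 + (k + 1)) = 2 * 2 ^ (t + 3 + k) := by ring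
    rw [show t + 2 + k + 1 = t + 3 + k by ring] at hU
    have := ih (by omega)
    omega

theorem valU_onesWord (d t : ℕ) :
    valU ((onesWord d t).map Fin.val).reverse + 2 ^ (t + 3) + d =
      2 ^ (t + 3 + d) + Useq t := by
  have h := onesSum_add (t := t) (le_refl d)
  rwa [onesSum, ← length_onesWord] at h

theorem isGreedyU_onesWord {d t : ℕ} (hd : d ≠ 0) : IsGreedyU (onesWord d t) := by
  constructor
  · obtain ⟨d, rfl⟩ := Nat.exists_eq_succ_of_ne_zero hd
    simp [onesWord, List.replicate_succ]
  · intro j hj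
    rw [length_onesWord] at hj
    change onesSum d t (j + 1) < _
    have hU := Useq_add_one (j + 1)
    have ht := Useq_add_one t
    have hpos : 2 ≤ 2 ^ (j + 1 + 1) := Nat.le_self_pow (by omega) 2
    rcases lt_or_ge j t with h | h
    · rw [onesSum_of_le h]
      omega
    · obtain ⟨k, rfl⟩ := Nat.exists_eq_add_of_le h
      rcases k with _ | k
      · rw [add_zero, onesSum_succ_self] at *
        have : 2 ^ (t + 1 + 1) = 2 * 2 ^ (t + 1) := by ring
        omega
      · have hs := onesSum_add (t := t) (show k ≤ d by omega)
        rw [show t + (k + 1) + 1 = t + 2 + k by ring] at *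
        rw [show t + 2 + k + 1 = t + 3 + k by ring] at hU
        have : 2 ^ (t + 3) = 4 * 2 ^ (t + 1) := by ring
        omega

theorem valU_onesWord_Useq (t : ℕ) :
    valU ((onesWord (Useq t) t).map Fin.val).reverse + 2 ^ (t + 3) =
      2 ^ (t + 3 + Useq t) := by
  have := valU_onesWord (Useq t) t
  omega

theorem valU_onesWord_add_two_pow_ne {s t : ℕ} (hst : s < t) {m n : ℕ} (hnm : n < m) :
    valU ((onesWord (Useq s) t).map Fin.val).reverse + 2 ^ (n + 1) ≠ 2 ^ (m + 1) := by
  intro h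
  have hv := valU_onesWord (Useq s) t
  have hs := Useq_add_one s
  have ht := Useq_add_one t
  have hs1 : 2 ≤ 2 ^ (s + 1) := Nat.le_self_pow (by omega) 2
  have hlt : 2 ^ (s + 1) < 2 ^ (t + 1) := Nat.pow_lt_pow_right one_lt_two (by omega)
  have e2 : 2 ^ (t + 2) = 2 * 2 ^ (t + 1) := by ring
  have e3 : 2 ^ (t + 3) = 4 * 2 ^ (t + 1) := by ring
  have hle : 2 ^ (n + 1) ≤ 2 ^ m := Nat.pow_le_pow_right two_pos hnm
  have em : 2 ^ (m + 1) = 2 * 2 ^ m := by ring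
  have hpos : 0 < 2 ^ (n + 1) := Nat.two_pow_pos _
  obtain ⟨k, hk⟩ : ∃ k, Useq s = k + 1 := ⟨Useq s - 1, by omega⟩
  have hA : 2 ^ (t + 3 + Useq s) = 2 * 2 ^ (t + 3 + k) := by rw [hk]; ring
  have hk3 : 2 ^ (t + 3) ≤ 2 ^ (t + 3 + k) := Nat.pow_le_pow_right two_pos (by omega)
  have h1 : m < t + 3 + Useq s := (Nat.pow_lt_pow_iff_right one_lt_two).1 (by omega)
  have h2 : t + 3 + k < m + 1 := (Nat.pow_lt_pow_iff_right one_lt_two).1 (by omega)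
  obtain rfl : m = t + 3 + k := by omega
  have h3 : t + 2 < n + 1 := (Nat.pow_lt_pow_iff_right one_lt_two).1 (by omega)
  have h4 : n + 1 < t + 3 := (Nat.pow_lt_pow_iff_right one_lt_two).1 (by omega)
  omega

/-- the language over `{0,1,2}` of greedy `U`-representations whose value
lies in `X = {2^{m+1} − 2^{n+1} : m > n ≥ 0}` is not regular. -/
theorem stmt9 :
    ¬ Language.IsRegular
      ({w : List (Fin 3) | IsGreedyU w ∧
        ∃ m n : ℕ, n < m ∧
          valU ((w.map Fin.val).reverse) + 2 ^ (n + 1) = 2 ^ (m + 1)} :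
        Language (Fin 3)) := by
  rintro ⟨σ, _, M, hM⟩
  obtain ⟨s, t, hst, heq⟩ := Finite.exists_ne_map_eq_of_infinite
    fun t : ℕ => M.eval (List.replicate (Useq t) 1)
  wlog hlt : s < t generalizing s t
  · exact this t s hst.symm heq.symm (by omega)
  have hU : Useq t ≠ 0 := by
    have := Useq_add_one t
    have : 2 ≤ 2 ^ (t + 1) := Nat.le_self_pow (by omega) 2
    omega
  have hmem : onesWord (Useq t) t ∈ M.accepts := by
    rw [hM]
    exact ⟨isGreedyU_onesWord hU, t + 2 + Useq t, t + 2, by omega, by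
      rw [valU_onesWord_Useq]; congr 1; ring⟩
  have hmem' : onesWord (Useq s) t ∈ M.accepts := by
    rw [DFA.mem_accepts, onesWord, DFA.eval, DFA.evalFrom_of_append] at hmem ⊢
    exact (congrArg (fun q => M.evalFrom q _ ∈ M.accept) heq).mpr hmem
  rw [hM] at hmem'
  obtain ⟨-, m, n, hnm, h⟩ := hmem'
  exact valU_onesWord_add_two_pow_ne hlt hnm h
end

section
/- Let β be the unique real root greater than 1 of the polynomial x⁴ − 3x³ − 2x² − 3 (numerically β ≈ 3.61645). Define the β-transformation T_β : [0,1) → [0,1) by T_β(x) = βx − ⌊βx⌋, and for x₀ := 1 − 1/β³ define the digit sequence d : ℕ → ℕ by d[n] := ⌊β · T_β^n(x₀)⌋ (so that d is the β-expansion of 1 − 1/β³). Then the sequence d is not eventually periodic. -/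
/-- The β-transformation `T_β(x) = βx − ⌊βx⌋`. -/
noncomputable def betaMap (β : ℝ) (x : ℝ) : ℝ := Int.fract (β * x)

/-- The digit sequence of the β-expansion of `x₀`: `d[n] = ⌊β · T_β^n(x₀)⌋`. -/
noncomputable def betaDigits (β x₀ : ℝ) (n : ℕ) : ℤ := ⌊β * (betaMap β)^[n] x₀⌋

theorem exists_quartic_root_mem_Icc {l u : ℝ} (hlu : l ≤ u)
    (h : (l ^ 4 - 3 * l ^ 3 - 2 * l ^ 2 - 3) * (u ^ 4 - 3 * u ^ 3 - 2 * u ^ 2 - 3) ≤ 0) :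
    ∃ x ∈ Set.Icc l u, x ^ 4 - 3 * x ^ 3 - 2 * x ^ 2 - 3 = 0 := by
  have hc : ContinuousOn (fun x : ℝ => x ^ 4 - 3 * x ^ 3 - 2 * x ^ 2 - 3) (Set.Icc l u) := by
    fun_prop
  rcases mul_nonpos_iff.1 h with ⟨h1, h2⟩ | ⟨h1, h2⟩
  · exact intermediate_value_Icc' hlu hc ⟨h2, h1⟩
  · exact intermediate_value_Icc hlu hc ⟨h1, h2⟩

/-- If every power of `2` divides an integer, it vanishes. -/
theorem Int.eq_zero_of_forall_two_pow_dvd {a : ℤ} (h : ∀ n : ℕ, (2 : ℤ) ^ n ∣ a) : a = 0 := by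
  refine Int.eq_zero_of_abs_lt_dvd (h a.natAbs) ?_
  rw [Int.abs_eq_natAbs]
  exact_mod_cast Nat.lt_two_pow_self

/-- The matrix of multiplication by `a + b r + c r² + e r³` in the basis `1, r, r², r³`,
for `r` a root of `x⁴ − 3x³ − 2x² − 3`. -/
def quarticMulMatrix {R : Type*} [CommRing R] (a b c e : R) : Matrix (Fin 4) (Fin 4) R :=
  !![a, b, c, e;
     3 * e, a, b + 2 * e, c + 3 * e;
     3 * c + 9 * e, 3 * e, a + 2 * c + 6 * e, b + 3 * c + 11 * e;
     3 * b + 9 * c + 33 * e, 3 * c + 9 * e, 2 * b + 6 * c + 25 * e, a + 3 * b + 11 * c + 39 * e]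

theorem quarticMulMatrix_det_intCast {R : Type*} [CommRing R] (a b c e : ℤ) :
    (quarticMulMatrix (a : R) b c e).det = ((quarticMulMatrix a b c e).det : ℤ) := by
  rw [Int.cast_det]
  congr 1
  ext i j
  fin_cases i <;> fin_cases j <;> simp [quarticMulMatrix]

theorem quarticMulMatrix_det_ne_zero_mod_two (a b c e : ZMod 2)
    (h : (quarticMulMatrix a b c e).det = 0) : a = 0 ∧ b = 0 ∧ c = 0 ∧ e = 0 := by
  simp only [quarticMulMatrix, Matrix.det_succ_row_zero, Fin.sum_univ_succ] at h
  revert a b c e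
  decide

theorem quartic_root_coeffs_even {β : ℝ} (hroot : β ^ 4 - 3 * β ^ 3 - 2 * β ^ 2 - 3 = 0)
    {a b c e : ℤ} (h : (a : ℝ) + b * β + c * β ^ 2 + e * β ^ 3 = 0) :
    (2 ∣ a) ∧ (2 ∣ b) ∧ (2 ∣ c) ∧ ((2 : ℤ) ∣ e) := by
  have hdet : (quarticMulMatrix (a : ℝ) b c e).det = 0 := by
    refine Matrix.exists_mulVec_eq_zero_iff.1 ⟨![1, β, β ^ 2, β ^ 3], ?_, ?_⟩
    · intro h0
      simpa using congrFun h0 0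
    · ext i
      fin_cases i <;>
        simp [quarticMulMatrix, Matrix.mulVec, dotProduct, Fin.sum_univ_succ]
      · linear_combination h
      · linear_combination β * h - e * hroot
      · linear_combination β ^ 2 * h - (c + 3 * e + e * β) * hroot
      · linear_combination β ^ 3 * h -
          (b + 3 * c + 11 * e + (c + 3 * e) * β + e * β ^ 2) * hroot
  rw [quarticMulMatrix_det_intCast, Int.cast_eq_zero] at hdet
  have hmod : (quarticMulMatrix (a : ZMod 2) b c e).det = 0 := by
    rw [quarticMulMatrix_det_intCast, hdet, Int.cast_zero]
  simpa only [ZMod.intCast_zmod_eq_zero_iff_dvd, Nat.cast_ofNat]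
    using quarticMulMatrix_det_ne_zero_mod_two _ _ _ _ hmod

theorem quartic_root_coeffs_two_pow_dvd {β : ℝ}
    (hroot : β ^ 4 - 3 * β ^ 3 - 2 * β ^ 2 - 3 = 0) (n : ℕ) :
    ∀ {a b c e : ℤ}, (a : ℝ) + b * β + c * β ^ 2 + e * β ^ 3 = 0 →
      (2 ^ n ∣ a) ∧ (2 ^ n ∣ b) ∧ (2 ^ n ∣ c) ∧ ((2 : ℤ) ^ n ∣ e) := by
  induction n with
  | zero => simp
  | succ n ih =>
    intro a b c e h
    obtain ⟨⟨a, rfl⟩, ⟨b, rfl⟩, ⟨c, rfl⟩, ⟨e, rfl⟩⟩ := quartic_root_coeffs_even hroot h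
    push_cast at h
    obtain ⟨ha, hb, hc, he⟩ := ih (a := a) (b := b) (c := c) (e := e) (by linarith)
    simp only [pow_succ']
    exact ⟨mul_dvd_mul_left 2 ha, mul_dvd_mul_left 2 hb, mul_dvd_mul_left 2 hc,
      mul_dvd_mul_left 2 he⟩

/-- A real root of `x⁴ − 3x³ − 2x² − 3` satisfies no nontrivial integer relation of degree less
than `4`. -/
theorem quartic_root_coeffs_eq_zero {β : ℝ} (hroot : β ^ 4 - 3 * β ^ 3 - 2 * β ^ 2 - 3 = 0)
    {a b c e : ℤ} (h : (a : ℝ) + b * β + c * β ^ 2 + e * β ^ 3 = 0) :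
    a = 0 ∧ b = 0 ∧ c = 0 ∧ e = 0 := by
  have key := fun n => quartic_root_coeffs_two_pow_dvd hroot n h
  exact ⟨Int.eq_zero_of_forall_two_pow_dvd fun n => (key n).1,
    Int.eq_zero_of_forall_two_pow_dvd fun n => (key n).2.1,
    Int.eq_zero_of_forall_two_pow_dvd fun n => (key n).2.2.1,
    Int.eq_zero_of_forall_two_pow_dvd fun n => (key n).2.2.2⟩

/-- Evaluation at `r` of the cubic polynomial with coefficients `v`. -/
def cubicEval (r : ℝ) (v : Fin 4 → ℤ) : ℝ := v 0 + v 1 * r + v 2 * r ^ 2 + v 3 * r ^ 3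

/-- Coefficients of `r · v(r) − d` reduced modulo `r⁴ = 3r³ + 2r² + 3`. -/
def shiftCoeffs (v : Fin 4 → ℤ) (d : ℤ) : Fin 4 → ℤ :=
  ![3 * v 3 - d, v 0, v 1 + 2 * v 3, v 2 + 3 * v 3]

/-- The orbit of `6 − 3r + 4r² − r³` under `z ↦ r z − d k`, in coordinates. -/
def orbitCoeffs (d : ℕ → ℤ) : ℕ → Fin 4 → ℤ
  | 0 => ![6, -3, 4, -1]
  | k + 1 => shiftCoeffs (orbitCoeffs d k) (d k)

theorem cubicEval_injective {β : ℝ} (hroot : β ^ 4 - 3 * β ^ 3 - 2 * β ^ 2 - 3 = 0) :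
    Function.Injective (cubicEval β) := by
  intro v w h
  simp only [cubicEval] at h
  obtain ⟨h0, h1, h2, h3⟩ := quartic_root_coeffs_eq_zero hroot
    (a := v 0 - w 0) (b := v 1 - w 1) (c := v 2 - w 2) (e := v 3 - w 3)
    (by push_cast; linarith)
  ext i
  fin_cases i <;> simp <;> omega

theorem cubicEval_shiftCoeffs {r : ℝ} (hroot : r ^ 4 - 3 * r ^ 3 - 2 * r ^ 2 - 3 = 0)
    (v : Fin 4 → ℤ) (d : ℤ) : cubicEval r (shiftCoeffs v d) = r * cubicEval r v - d := by
  simp [cubicEval, shiftCoeffs]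
  linear_combination -(v 3 : ℝ) * hroot

theorem cubicEval_orbitCoeffs_strictMono {γ : ℝ} (hγ : γ ∈ Set.Icc (-1.0969 : ℝ) (-1.0968))
    (hroot : γ ^ 4 - 3 * γ ^ 3 - 2 * γ ^ 2 - 3 = 0) {d : ℕ → ℤ}
    (hd : ∀ k, 0 ≤ d k ∧ d k ≤ 3) :
    StrictMono fun k => cubicEval γ (orbitCoeffs d (2 * k)) := by
  obtain ⟨hl, hu⟩ := hγ
  have hsq : (1.2029 : ℝ) ≤ γ ^ 2 := by nlinarith
  have hcube : γ ^ 3 ≤ -1.319 := by nlinarith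
  have hstep : ∀ k, cubicEval γ (orbitCoeffs d (2 * (k + 1))) ≥
      γ ^ 2 * cubicEval γ (orbitCoeffs d (2 * k)) - 3 := by
    intro k
    have h1 : orbitCoeffs d (2 * (k + 1)) =
        shiftCoeffs (shiftCoeffs (orbitCoeffs d (2 * k)) (d (2 * k))) (d (2 * k + 1)) := rfl
    rw [h1, cubicEval_shiftCoeffs hroot, cubicEval_shiftCoeffs hroot]
    have h2 : (0 : ℝ) ≤ d (2 * k) := by exact_mod_cast (hd _).1
    have h3 : (d (2 * k + 1) : ℝ) ≤ 3 := by exact_mod_cast (hd _).2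
    nlinarith
  have hbig : ∀ k, 15.4 ≤ cubicEval γ (orbitCoeffs d (2 * k)) := by
    intro k
    induction k with
    | zero =>
      simp [cubicEval, orbitCoeffs]
      nlinarith
    | succ k ih => nlinarith [hstep k]
  refine strictMono_nat_of_lt_succ fun k => ?_
  nlinarith [hstep k, hbig k]

theorem betaMap_iterate_succ (β x : ℝ) (n : ℕ) :
    (betaMap β)^[n + 1] x = β * (betaMap β)^[n] x - betaDigits β x n := by
  rw [Function.iterate_succ_apply', betaMap, betaDigits, Int.fract]

theorem betaMap_iterate_mem_Ico {β x : ℝ} (hx : x ∈ Set.Ico (0 : ℝ) 1) (n : ℕ) :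
    (betaMap β)^[n] x ∈ Set.Ico (0 : ℝ) 1 := by
  cases n with
  | zero => exact hx
  | succ n =>
    rw [Function.iterate_succ_apply', betaMap]
    exact ⟨Int.fract_nonneg _, Int.fract_lt_one _⟩

/-- Points of a `β`-orbit with the same subsequent digits coincide. -/
theorem betaMap_iterate_eq_of_betaDigits_eq {β x : ℝ} (hβ : 1 < β)
    (hx : x ∈ Set.Ico (0 : ℝ) 1) {m n : ℕ}
    (h : ∀ k, betaDigits β x (m + k) = betaDigits β x (n + k)) :
    (betaMap β)^[m] x = (betaMap β)^[n] x := by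
  by_contra hne
  have hdiff : ∀ k, (betaMap β)^[m + k] x - (betaMap β)^[n + k] x =
      β ^ k * ((betaMap β)^[m] x - (betaMap β)^[n] x) := by
    intro k
    induction k with
    | zero => simp
    | succ k ih =>
      rw [← add_assoc, ← add_assoc, betaMap_iterate_succ, betaMap_iterate_succ, h k]
      linear_combination β * ih
  have hpos : 0 < |(betaMap β)^[m] x - (betaMap β)^[n] x| := abs_pos.2 (sub_ne_zero.2 hne)
  obtain ⟨k, hk⟩ := pow_unbounded_of_one_lt (1 / |(betaMap β)^[m] x - (betaMap β)^[n] x|) hβ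
  rw [div_lt_iff₀ hpos, ← abs_of_pos (pow_pos (zero_lt_one.trans hβ) k), ← abs_mul,
    ← hdiff k] at hk
  have h1 := betaMap_iterate_mem_Ico (β := β) hx (m + k)
  have h2 := betaMap_iterate_mem_Ico (β := β) hx (n + k)
  exact absurd hk (not_lt.2 (abs_le.2 ⟨by linarith [h1.1, h2.2], by linarith [h1.2, h2.1]⟩))

theorem betaMap_eq_of_digit {β x y : ℝ} (d : ℤ) (h : β * x = y + d) (h0 : 0 ≤ y) (h1 : y < 1) :
    betaMap β x = y := by
  rw [betaMap, Int.fract_eq_iff]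
  exact ⟨h0, h1, d, by linarith⟩

theorem one_sub_one_div_cube {β : ℝ} (hβ : 1 < β)
    (hroot : β ^ 4 - 3 * β ^ 3 - 2 * β ^ 2 - 3 = 0) :
    1 - 1 / β ^ 3 = 2 - 7 / 9 * β - 2 / 3 * β ^ 2 + 2 / 9 * β ^ 3 := by
  have : β ≠ 0 := by positivity
  field_simp
  linear_combination (-6 * β ^ 2 + 9) * hroot

theorem betaMap_iterate_ten {β : ℝ} (hβ : β ∈ Set.Icc (3.616454543 : ℝ) 3.616454544)
    (hroot : β ^ 4 - 3 * β ^ 3 - 2 * β ^ 2 - 3 = 0) :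
    (betaMap β)^[10] (1 - 1 / β ^ 3) = cubicEval β ![6, -3, 4, -1] := by
  obtain ⟨hl, hu⟩ := hβ
  have hl2 : (3.616454543 : ℝ) ^ 2 ≤ β ^ 2 := by gcongr
  have hu2 : β ^ 2 ≤ (3.616454544 : ℝ) ^ 2 := by gcongr
  have hl3 : (3.616454543 : ℝ) ^ 3 ≤ β ^ 3 := by gcongr
  have hu3 : β ^ 3 ≤ (3.616454544 : ℝ) ^ 3 := by gcongr
  norm_num at hl2 hu2 hl3 hu3
  have h1 : betaMap β (2 - 7 / 9 * β - 2 / 3 * β ^ 2 + 2 / 9 * β ^ 3) =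
      -7 / 3 + 2 * β - 1 / 3 * β ^ 2 :=
    betaMap_eq_of_digit 3 (by push_cast; linear_combination 2 / 9 * hroot)
      (by linarith) (by linarith)
  have h2 : betaMap β (-7 / 3 + 2 * β - 1 / 3 * β ^ 2) =
      -1 - 7 / 3 * β + 2 * β ^ 2 - 1 / 3 * β ^ 3 :=
    betaMap_eq_of_digit 1 (by push_cast; ring) (by linarith) (by linarith)
  have h3 : betaMap β (-1 - 7 / 3 * β + 2 * β ^ 2 - 1 / 3 * β ^ 3) =
      -4 - β - 3 * β ^ 2 + β ^ 3 :=
    betaMap_eq_of_digit 3 (by push_cast; linear_combination -1 / 3 * hroot)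
      (by linarith) (by linarith)
  have h4 : betaMap β (-4 - β - 3 * β ^ 2 + β ^ 3) = 2 - 4 * β + β ^ 2 :=
    betaMap_eq_of_digit 1 (by push_cast; linear_combination hroot) (by linarith) (by linarith)
  have h5 : betaMap β (2 - 4 * β + β ^ 2) = -2 + 2 * β - 4 * β ^ 2 + β ^ 3 :=
    betaMap_eq_of_digit 2 (by push_cast; ring) (by linarith) (by linarith)
  have h6 : betaMap β (-2 + 2 * β - 4 * β ^ 2 + β ^ 3) = 3 - 2 * β + 4 * β ^ 2 - β ^ 3 :=
    betaMap_eq_of_digit 0 (by push_cast; linear_combination hroot) (by linarith) (by linarith)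
  have h7 : betaMap β (3 - 2 * β + 4 * β ^ 2 - β ^ 3) = -5 + 3 * β - 4 * β ^ 2 + β ^ 3 :=
    betaMap_eq_of_digit 2 (by push_cast; linear_combination -hroot) (by linarith) (by linarith)
  have h8 : betaMap β (-5 + 3 * β - 4 * β ^ 2 + β ^ 3) = -5 * β + 5 * β ^ 2 - β ^ 3 :=
    betaMap_eq_of_digit 3 (by push_cast; linear_combination hroot) (by linarith) (by linarith)
  have h9 : betaMap β (-5 * β + 5 * β ^ 2 - β ^ 3) = -3 - 7 * β ^ 2 + 2 * β ^ 3 :=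
    betaMap_eq_of_digit 0 (by push_cast; linear_combination -hroot) (by linarith) (by linarith)
  have h10 : betaMap β (-3 - 7 * β ^ 2 + 2 * β ^ 3) = 6 - 3 * β + 4 * β ^ 2 - β ^ 3 :=
    betaMap_eq_of_digit 0 (by push_cast; linear_combination 2 * hroot)
      (by linarith) (by linarith)
  rw [one_sub_one_div_cube (by linarith) hroot]
  simp only [Function.iterate_succ_apply, Function.iterate_zero_apply,
    h1, h2, h3, h4, h5, h6, h7, h8, h9, h10]
  simp [cubicEval]
  ring

/-- let `β` be the unique real root greater than `1` of
`x⁴ − 3x³ − 2x² − 3`. Then the digit sequence of the β-expansion of `1 − 1/β³`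
is not eventually periodic. -/
theorem stmt10 (β : ℝ) (hβ : 1 < β)
    (hroot : β ^ 4 - 3 * β ^ 3 - 2 * β ^ 2 - 3 = 0)
    (huniq : ∀ x : ℝ, 1 < x → x ^ 4 - 3 * x ^ 3 - 2 * x ^ 2 - 3 = 0 → x = β) :
    ¬ ∃ (N p : ℕ), 1 ≤ p ∧ ∀ n ≥ N,
      betaDigits β (1 - 1 / β ^ 3) (n + p) = betaDigits β (1 - 1 / β ^ 3) n := by
  rintro ⟨N, p, hp, hper⟩
  have hβI : β ∈ Set.Icc (3.616454543 : ℝ) 3.616454544 := by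
    obtain ⟨x, hx, hxr⟩ := exists_quartic_root_mem_Icc
      (l := 3.616454543) (u := 3.616454544) (by norm_num) (by norm_num)
    rwa [← huniq x (by linarith [hx.1]) hxr]
  obtain ⟨γ, hγ, hγr⟩ := exists_quartic_root_mem_Icc
    (l := -1.0969) (u := -1.0968) (by norm_num) (by norm_num)
  have hten := betaMap_iterate_ten hβI hroot
  set x₀ : ℝ := 1 - 1 / β ^ 3 with hx₀def
  have hx₀ : x₀ ∈ Set.Ico (0 : ℝ) 1 := by
    have h1 : 1 < β ^ 3 := one_lt_pow₀ hβ (by norm_num)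
    have h2 : 1 / β ^ 3 ≤ 1 := (div_le_one (by linarith)).2 h1.le
    have h3 : 0 < 1 / β ^ 3 := by positivity
    exact ⟨by linarith, by linarith⟩
  have hdig : ∀ n, 0 ≤ betaDigits β x₀ n ∧ betaDigits β x₀ n ≤ 3 := by
    intro n
    have hn := betaMap_iterate_mem_Ico (β := β) hx₀ n
    refine ⟨Int.floor_nonneg.2 (mul_nonneg (by linarith) hn.1), ?_⟩
    refine Int.lt_add_one_iff.1 (Int.floor_lt.2 ?_)
    push_cast
    nlinarith [hn.1, hn.2, hβI.2]
  let V := orbitCoeffs fun k => betaDigits β x₀ (10 + k)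
  have hV : ∀ k, (betaMap β)^[10 + k] x₀ = cubicEval β (V k) := by
    intro k
    induction k with
    | zero => exact hten
    | succ k ih =>
      rw [← add_assoc, betaMap_iterate_succ, ih]
      exact (cubicEval_shiftCoeffs hroot _ _).symm
  have hmono := cubicEval_orbitCoeffs_strictMono hγ hγr fun k => hdig (10 + k)
  have horb : (betaMap β)^[10 + 2 * (N + p)] x₀ = (betaMap β)^[10 + 2 * N] x₀ := by
    refine betaMap_iterate_eq_of_betaDigits_eq hβ hx₀ fun k => ?_
    rw [← hper (10 + 2 * N + k) (by omega), ← hper (10 + 2 * N + k + p) (by omega)]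
    congr 1
    ring
  rw [hV, hV] at horb
  have hlt : cubicEval γ (V (2 * N)) < cubicEval γ (V (2 * (N + p))) :=
    hmono (by omega : N < N + p)
  rw [cubicEval_injective hroot horb] at hlt
  exact lt_irrefl _ hlt
end
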